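/- arXiv:2602.01462 — 2 statements merged into one kernel-verified Lean document; each statement's English description precedes it below -/
import Mathlib

section
/- Let G=(V,E,u) be a finite capacitated undirected graph with nonnegative edge capacities and let λ∈ℝ. Then the family of non-trivial small cuts {S : ∅≠S⊊V, u(δ_E(S))<λ} satisfies both property (γ) and property (γ*). -/
/-- Two subsets `A, B` of the ground set `V` cross if all four sets
`A ∩ B`, `A \ B`, `B \ A`, `V \ (A ∪ B)` are nonempty. -/
def Crosses {V : Type*} (A B : Set V) : Prop :=
  (A ∩ B).Nonempty ∧ (A \ B).Nonempty ∧ (B \ A).Nonempty ∧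
    (Set.univ \ (A ∪ B)).Nonempty

/-- At least two of the four propositions hold. -/
def AtLeastTwo (p q r s : Prop) : Prop :=
  (p ∧ q) ∨ (p ∧ r) ∨ (p ∧ s) ∨ (q ∧ r) ∨ (q ∧ s) ∨ (r ∧ s)

/-- A family `F` of subsets of `V` (with `∅ ∉ F` and `V ∉ F`) is pliable if for
every pair `A, B ∈ F`, at least two of `A ∩ B`, `A ∪ B`, `A \ B`, `B \ A` are in `F`. -/
def Pliable {V : Type*} (F : Set (Set V)) : Prop :=
  ∅ ∉ F ∧ Set.univ ∉ F ∧
    ∀ A ∈ F, ∀ B ∈ F, AtLeastTwo (A ∩ B ∈ F) (A ∪ B ∈ F) (A \ B ∈ F) (B \ A ∈ F)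

/-- `F` satisfies symmetry: `S ∈ F` iff `V \ S ∈ F`. -/
def SymmFamily {V : Type*} (F : Set (Set V)) : Prop :=
  ∀ S : Set V, S ∈ F ↔ (Set.univ \ S) ∈ F

/-- `F` satisfies structural submodularity: for every crossing pair `A, B ∈ F`,
at least one of `A ∩ B`, `A ∪ B` is in `F` and at least one of `A \ B`, `B \ A` is in `F`. -/
def StructSubmodular {V : Type*} (F : Set (Set V)) : Prop :=
  ∀ A ∈ F, ∀ B ∈ F, Crosses A B →
    ((A ∩ B ∈ F ∨ A ∪ B ∈ F) ∧ (A \ B ∈ F ∨ B \ A ∈ F))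

/-- `δ_J(S)`: the edges (unordered pairs) of `J` with exactly one endpoint in `S`. -/
def cutLinks {V : Type*} (J : Set (Sym2 V)) (S : Set V) : Set (Sym2 V) :=
  {e ∈ J | ∃ x y, e = s(x, y) ∧ x ∈ S ∧ y ∉ S}

/-- `F_Ê`: the members of `F` not covered by the edge set `Ê`. -/
def uncovered {V : Type*} (F : Set (Set V)) (E : Set (Sym2 V)) : Set (Set V) :=
  {S ∈ F | cutLinks E S = ∅}

/-- `C` is an inclusion-minimal member of `F`: `C ∈ F` and no proper subset of `C` is in `F`. -/
def MinimalIn {V : Type*} (F : Set (Set V)) (C : Set V) : Prop :=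
  C ∈ F ∧ ∀ S : Set V, S ⊂ C → S ∉ F

/-- `C_Ê`: the family of inclusion-minimal members of `F_Ê`. -/
def cores {V : Type*} (F : Set (Set V)) (E : Set (Sym2 V)) : Set (Set V) :=
  {C | MinimalIn (uncovered F E) C}


open Classical in
/-- `u(δ_E(S))`: total capacity of the edges of `E` with exactly one endpoint in `S`. -/
noncomputable def cutCap {V : Type*} (E : Finset (Sym2 V)) (u : Sym2 V → ℝ) (S : Set V) : ℝ :=
  ∑ e ∈ E, if ∃ x y, e = s(x, y) ∧ x ∈ S ∧ y ∉ S then u e else 0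

/-- Property (γ). -/
def PropGamma {V : Type*} (F : Set (Set V)) : Prop :=
  ∀ (E : Set (Sym2 V)) (S₀ S₁ C : Set V),
    S₀ ∈ uncovered F E → S₁ ∈ uncovered F E → S₁ ⊂ S₀ →
    C ∈ cores F E → Crosses C S₀ → Crosses C S₁ →
    S₀ \ (C ∪ S₁) = ∅ ∨ S₀ \ (C ∪ S₁) ∈ uncovered F E

/-- Property (γ*). -/
def PropGammaStar {V : Type*} (F : Set (Set V)) : Prop :=
  ∀ (E : Set (Sym2 V)) (k : ℕ), 1 ≤ k →
    ∀ (S₀ : Set V) (S : Fin k → Set V) (C : Set V),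
      S₀ ∈ uncovered F E → (∀ i, S i ∈ uncovered F E) →
      (∀ i, S i ⊂ S₀) → (∀ i j, i ≠ j → Disjoint (S i) (S j)) →
      C ∈ cores F E → Crosses C S₀ → (∀ i, Crosses C (S i)) →
      S₀ \ ((⋃ i, S i) ∪ C) = ∅ ∨ S₀ \ ((⋃ i, S i) ∪ C) ∈ uncovered F E

open Classical in
theorem cutCap_pointwise_mono {V : Type*} (E : Finset (Sym2 V)) (u : Sym2 V → ℝ)
    (hu : ∀ e, 0 ≤ u e) (A B X Y : Set V)
    (h : ∀ x y : V, ∀ c : ℝ, 0 ≤ c →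
      (if (x ∈ X ∧ y ∉ X) ∨ (y ∈ X ∧ x ∉ X) then c else 0) +
        (if (x ∈ Y ∧ y ∉ Y) ∨ (y ∈ Y ∧ x ∉ Y) then c else 0) ≤
      (if (x ∈ A ∧ y ∉ A) ∨ (y ∈ A ∧ x ∉ A) then c else 0) +
        (if (x ∈ B ∧ y ∉ B) ∨ (y ∈ B ∧ x ∉ B) then c else 0)) :
    cutCap E u X + cutCap E u Y ≤ cutCap E u A + cutCap E u B := by
  have key : ∀ (x y : V) (S : Set V), (∃ a b, s(x, y) = s(a, b) ∧ a ∈ S ∧ b ∉ S) ↔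
      ((x ∈ S ∧ y ∉ S) ∨ (y ∈ S ∧ x ∉ S)) := by
    intro x y S
    constructor
    · rintro ⟨a, b, hab, ha, hb⟩
      rcases Sym2.eq_iff.1 hab with ⟨rfl, rfl⟩ | ⟨rfl, rfl⟩
      · exact Or.inl ⟨ha, hb⟩
      · exact Or.inr ⟨ha, hb⟩
    · rintro (⟨ha, hb⟩ | ⟨ha, hb⟩)
      · exact ⟨x, y, rfl, ha, hb⟩
      · exact ⟨y, x, Sym2.eq_swap, ha, hb⟩
  unfold cutCap
  rw [← Finset.sum_add_distrib, ← Finset.sum_add_distrib]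
  refine Finset.sum_le_sum fun e _ => ?_
  induction e using Sym2.ind with
  | _ x y =>
    simp only [key]
    exact h x y _ (hu _)

theorem cutCap_inter_add_union_le {V : Type*} (E : Finset (Sym2 V)) (u : Sym2 V → ℝ)
    (hu : ∀ e, 0 ≤ u e) (A B : Set V) :
    cutCap E u (A ∩ B) + cutCap E u (A ∪ B) ≤ cutCap E u A + cutCap E u B := by
  refine cutCap_pointwise_mono E u hu _ _ _ _ fun x y c hc => ?_
  by_cases h1 : x ∈ A <;> by_cases h2 : x ∈ B <;> by_cases h3 : y ∈ A <;>
    by_cases h4 : y ∈ B <;> simp [h1, h2, h3, h4, hc]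

theorem cutCap_diff_add_diff_le {V : Type*} (E : Finset (Sym2 V)) (u : Sym2 V → ℝ)
    (hu : ∀ e, 0 ≤ u e) (A B : Set V) :
    cutCap E u (A \ B) + cutCap E u (B \ A) ≤ cutCap E u A + cutCap E u B := by
  refine cutCap_pointwise_mono E u hu _ _ _ _ fun x y c hc => ?_
  by_cases h1 : x ∈ A <;> by_cases h2 : x ∈ B <;> by_cases h3 : y ∈ A <;>
    by_cases h4 : y ∈ B <;> simp [h1, h2, h3, h4, hc]

theorem cutLinks_eq_empty_iff {V : Type*} (J : Set (Sym2 V)) (S : Set V) :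
    cutLinks J S = ∅ ↔ ∀ x y, s(x, y) ∈ J → x ∈ S → y ∈ S := by
  constructor
  · intro h x y hxy hx
    by_contra hy
    have : s(x, y) ∈ cutLinks J S := ⟨hxy, x, y, rfl, hx, hy⟩
    simp [h] at this
  · intro h
    ext e
    simp only [Set.mem_empty_iff_false, iff_false]
    rintro ⟨he, x, y, rfl, hx, hy⟩
    exact hy (h x y he hx)

theorem cutLinks_diff_eq_empty {V : Type*} {J : Set (Sym2 V)} {A B : Set V}
    (hA : cutLinks J A = ∅) (hB : cutLinks J B = ∅) : cutLinks J (A \ B) = ∅ := by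
  rw [cutLinks_eq_empty_iff] at *
  exact fun x y hxy hx =>
    ⟨hA x y hxy hx.1, fun hy => hx.2 (hB y x (Sym2.eq_swap (a := x) ▸ hxy) hy)⟩

theorem cutLinks_union_eq_empty {V : Type*} {J : Set (Sym2 V)} {A B : Set V}
    (hA : cutLinks J A = ∅) (hB : cutLinks J B = ∅) : cutLinks J (A ∪ B) = ∅ := by
  rw [cutLinks_eq_empty_iff] at *
  exact fun x y hxy hx => hx.imp (hA x y hxy) (hB x y hxy)

theorem cutLinks_iUnion_eq_empty {V ι : Type*} {J : Set (Sym2 V)} {S : ι → Set V}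
    (hS : ∀ i, cutLinks J (S i) = ∅) : cutLinks J (⋃ i, S i) = ∅ := by
  simp only [cutLinks_eq_empty_iff] at *
  intro x y hxy hx
  obtain ⟨i, hi⟩ := Set.mem_iUnion.1 hx
  exact Set.mem_iUnion.2 ⟨i, hS i x y hxy hi⟩

/-- Adding pairwise disjoint sets to `C`, none of which increases the cut capacity of `C`
on its own, does not increase the cut capacity of `C`. -/
theorem cutCap_biUnion_union_le {V ι : Type*} (E : Finset (Sym2 V)) (u : Sym2 V → ℝ)
    (hu : ∀ e, 0 ≤ u e) (S : ι → Set V) (C : Set V)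
    (hdisj : ∀ i j, i ≠ j → Disjoint (S i) (S j))
    (h : ∀ i, cutCap E u (S i ∪ C) ≤ cutCap E u C) (t : Finset ι) :
    cutCap E u ((⋃ i ∈ t, S i) ∪ C) ≤ cutCap E u C := by
  classical
  induction t using Finset.induction_on with
  | empty => simp
  | insert a t ha ih =>
    have hd : Disjoint (S a) (⋃ i ∈ t, S i) := by
      simp only [Set.disjoint_iUnion_right]
      exact fun i hi => hdisj a i fun hai => ha (hai ▸ hi)
    have hinter : (S a ∪ C) ∩ ((⋃ i ∈ t, S i) ∪ C) = C := by
      rw [← Set.inter_union_distrib_right, hd.inter_eq, Set.empty_union]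
    have hunion : (S a ∪ C) ∪ ((⋃ i ∈ t, S i) ∪ C) = (⋃ i ∈ insert a t, S i) ∪ C := by
      rw [Finset.set_biUnion_insert, ← Set.union_union_distrib_right]
    have hsub := cutCap_inter_add_union_le E u hu (S a ∪ C) ((⋃ i ∈ t, S i) ∪ C)
    rw [hinter, hunion] at hsub
    linarith [h a]

theorem propGammaStar_smallCuts {V : Type*} (E : Finset (Sym2 V)) (u : Sym2 V → ℝ)
    (hu : ∀ e, 0 ≤ u e) (lam : ℝ) :
    PropGammaStar {S : Set V | S.Nonempty ∧ S ≠ Set.univ ∧ cutCap E u S < lam} := by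
  rintro J k - S₀ S C ⟨⟨-, hS₀V, hS₀⟩, hJ₀⟩ hS hsub hdisj
    ⟨⟨⟨-, hCV, hC⟩, hJC⟩, hmin⟩ hcross₀ hcross
  have large_diff : ∀ X : Set V, cutLinks J X = ∅ → (C ∩ X).Nonempty → (C \ X).Nonempty →
      lam ≤ cutCap E u (C \ X) := by
    rintro X hX ⟨x, hxC, hxX⟩ hne
    by_contra! hlt
    exact hmin (C \ X) ⟨Set.sdiff_subset, fun h => (h hxC).2 hxX⟩
      ⟨⟨hne, fun h => hCV (Set.univ_subset_iff.1 (h ▸ Set.sdiff_subset)), hlt⟩,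
        cutLinks_diff_eq_empty hJC hX⟩
  have large_inter : ∀ X : Set V, cutLinks J X = ∅ → (C ∩ X).Nonempty → (C \ X).Nonempty →
      lam ≤ cutCap E u (C ∩ X) := by
    intro X hX hi hd
    have := large_diff (C \ X) (cutLinks_diff_eq_empty hJC hX)
    rw [Set.inter_eq_right.2 Set.sdiff_subset, Set.sdiff_sdiff_right_self] at this
    exact this hd hi
  rcases Set.eq_empty_or_nonempty (S₀ \ ((⋃ i, S i) ∪ C)) with hT | hT
  · exact Or.inl hT
  right
  refine ⟨⟨hT, fun h => hS₀V (Set.univ_subset_iff.1 (h ▸ Set.sdiff_subset)), ?_⟩,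
    cutLinks_diff_eq_empty hJ₀
      (cutLinks_union_eq_empty (cutLinks_iUnion_eq_empty fun i => (hS i).2) hJC)⟩
  have hone : ∀ i, cutCap E u (S i ∪ C) ≤ cutCap E u C := fun i => by
    have h := cutCap_inter_add_union_le E u hu C (S i)
    rw [Set.union_comm C] at h
    linarith [(hS i).1.2.2, large_inter (S i) (hS i).2 (hcross i).1 (hcross i).2.1]
  have hall := cutCap_biUnion_union_le E u hu S C hdisj hone Finset.univ
  simp only [Finset.mem_univ, Set.iUnion_true] at hall
  have hdiff := cutCap_diff_add_diff_le E u hu C S₀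
  have hlarge := large_diff S₀ hJ₀ hcross₀.1 hcross₀.2.1
  have hpos := cutCap_diff_add_diff_le E u hu (S₀ \ C) ((⋃ i, S i) ∪ C)
  have hU : (⋃ i, S i) ⊆ S₀ := Set.iUnion_subset fun i => (hsub i).subset
  have hleft : (S₀ \ C) \ ((⋃ i, S i) ∪ C) = S₀ \ ((⋃ i, S i) ∪ C) := by
    ext x
    simp only [Set.mem_sdiff, Set.mem_union]
    tauto
  have hright : ((⋃ i, S i) ∪ C) \ (S₀ \ C) = C := by
    ext x
    have := @hU x
    simp only [Set.mem_sdiff, Set.mem_union]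
    tauto
  rw [hleft, hright] at hpos
  linarith

theorem PropGammaStar.propGamma {V : Type*} {F : Set (Set V)} (h : PropGammaStar F) :
    PropGamma F := by
  intro J S₀ S₁ C h₀ h₁ hsub hC hcross₀ hcross₁
  have := h J 1 le_rfl S₀ (fun _ => S₁) C h₀ (fun _ => h₁) (fun _ => hsub)
    (fun i j hij => absurd (Subsingleton.elim i j) hij) hC hcross₀ (fun _ => hcross₁)
  rwa [Set.iUnion_const, Set.union_comm] at this

/-- the family of non-trivial small cuts satisfies properties (γ) and (γ*). -/
theorem stmt8 {V : Type*} [Fintype V] (E : Finset (Sym2 V)) (u : Sym2 V → ℝ)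
    (hu : ∀ e, 0 ≤ u e) (lam : ℝ) :
    PropGamma {S : Set V | S.Nonempty ∧ S ≠ Set.univ ∧ cutCap E u S < lam} ∧
    PropGammaStar {S : Set V | S.Nonempty ∧ S ≠ Set.univ ∧ cutCap E u S < lam} :=
  ⟨(propGammaStar_smallCuts E u hu lam).propGamma, propGammaStar_smallCuts E u hu lam⟩
end

section
/- Let F be a pliable family of subsets of a finite ground set V that satisfies symmetry and structural submodularity, let Ê be a set of edges on V, and suppose S0,C∈F_Ê are such that C is inclusion-minimal in F_Ê and C crosses S0. If S1∈F_Ê is a proper subset of S0 that C also crosses, and S0\(C∪S1) is nonempty, then S1∪C ∈ F_Ê, S0 crosses S1∪C, and S0\(S1∪C) ∈ F_Ê. -/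
theorem mem_uncovered_iff {V : Type*} {F : Set (Set V)} {E : Set (Sym2 V)} {S : Set V} :
    S ∈ uncovered F E ↔ S ∈ F ∧ ∀ x y, s(x, y) ∈ E → x ∈ S → y ∈ S := by
  simp only [uncovered, cutLinks, Set.mem_sep_iff, Set.eq_empty_iff_forall_notMem]
  grind

theorem union_mem_uncovered {V : Type*} {F : Set (Set V)} {E : Set (Sym2 V)} {A B : Set V}
    (hA : A ∈ uncovered F E) (hB : B ∈ uncovered F E) (h : A ∪ B ∈ F) :
    A ∪ B ∈ uncovered F E := by
  rw [mem_uncovered_iff] at *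
  exact ⟨h, fun x y e hx => hx.imp (hA.2 x y e) (hB.2 x y e)⟩

theorem inter_mem_uncovered {V : Type*} {F : Set (Set V)} {E : Set (Sym2 V)} {A B : Set V}
    (hA : A ∈ uncovered F E) (hB : B ∈ uncovered F E) (h : A ∩ B ∈ F) :
    A ∩ B ∈ uncovered F E := by
  rw [mem_uncovered_iff] at *
  exact ⟨h, fun x y e hx => ⟨hA.2 x y e hx.1, hB.2 x y e hx.2⟩⟩

theorem sdiff_mem_uncovered {V : Type*} {F : Set (Set V)} {E : Set (Sym2 V)} {A B : Set V}
    (hA : A ∈ uncovered F E) (hB : B ∈ uncovered F E) (h : A \ B ∈ F) :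
    A \ B ∈ uncovered F E := by
  rw [mem_uncovered_iff] at *
  exact ⟨h, fun x y e hx =>
    ⟨hA.2 x y e hx.1, fun hy => hx.2 (hB.2 y x (Sym2.eq_swap ▸ e) hy)⟩⟩

/-- A minimal uncovered set `C` that crosses an uncovered set `S` has neither `C ∩ S` nor `C \ S`
in the family. -/
theorem MinimalIn.inter_sdiff_notMem {V : Type*} {F : Set (Set V)} {E : Set (Sym2 V)}
    {C S : Set V} (hC : MinimalIn (uncovered F E) C) (hS : S ∈ uncovered F E)
    (hCS : Crosses C S) : C ∩ S ∉ F ∧ C \ S ∉ F := by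
  obtain ⟨⟨a, ha⟩, ⟨b, hb⟩, -, -⟩ := hCS
  refine ⟨fun h => hC.2 _ ⟨Set.inter_subset_left, fun hs => hb.2 (hs hb.1).2⟩
    (inter_mem_uncovered hC.1 hS h), fun h => hC.2 _ ⟨Set.sdiff_subset, fun hs => ?_⟩
    (sdiff_mem_uncovered hC.1 hS h)⟩
  exact (hs ha.1).2 ha.2

/-- key step of the proof of property (γ). -/
theorem stmt14 {V : Type*} [Fintype V] (F : Set (Set V)) (E : Set (Sym2 V))
    (hPl : Pliable F) (hSym : SymmFamily F) (hSub : StructSubmodular F)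
    (S₀ C : Set V) (hS₀ : S₀ ∈ uncovered F E) (hC : C ∈ uncovered F E)
    (hCmin : MinimalIn (uncovered F E) C) (hCx : Crosses C S₀)
    (S₁ : Set V) (hS₁ : S₁ ∈ uncovered F E) (hS₁sub : S₁ ⊂ S₀)
    (hCx₁ : Crosses C S₁)
    (hne : (S₀ \ (C ∪ S₁)).Nonempty) :
    S₁ ∪ C ∈ uncovered F E ∧ Crosses S₀ (S₁ ∪ C) ∧
      S₀ \ (S₁ ∪ C) ∈ uncovered F E := by
  have h₀ := hCmin.inter_sdiff_notMem hS₀ hCx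
  have h₁ := hCmin.inter_sdiff_notMem hS₁ hCx₁
  have hU : S₁ ∪ C ∈ uncovered F E := by
    refine union_mem_uncovered hS₁ hC ?_
    have h := hPl.2.2 C hC.1 S₁ hS₁.1
    rw [Set.union_comm]
    unfold AtLeastTwo at h
    tauto
  have hD : (S₁ ∪ C) \ S₀ = C \ S₀ := by
    rw [Set.union_sdiff_distrib, Set.sdiff_eq_empty.2 hS₁sub.1, Set.empty_union]
  have hX : Crosses S₀ (S₁ ∪ C) := by
    refine ⟨?_, ?_, ?_, ?_⟩
    · exact hCx.1.mono fun x hx => ⟨hx.2, Or.inr hx.1⟩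
    · rwa [Set.union_comm]
    · rw [hD]
      exact hCx.2.1
    · refine hCx.2.2.2.mono fun x hx => ⟨hx.1, ?_⟩
      rintro (h | h | h)
      · exact hx.2 (Or.inr h)
      · exact hx.2 (Or.inr (hS₁sub.1 h))
      · exact hx.2 (Or.inl h)
  refine ⟨hU, hX, sdiff_mem_uncovered hS₀ hU ?_⟩
  refine (hSub S₀ hS₀.1 _ hU.1 hX).2.resolve_right ?_
  rw [hD]
  exact h₀.2
end
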